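/- arXiv:1904.05481 — 7 statements merged into one kernel-verified Lean document; each statement's English description precedes it below -/
import Mathlib

section
/- Let D be a family of bounded measurable functions from S to ℝ, let s(1) ∈ S, and let P₁, P₂ be Markov kernels on S, with (μ₁ᵗ) and (μ₂ᵗ) the induced state distributions starting from s(1). Suppose (a) P₂ is D-preserving, i.e., for every f ∈ D the function s ↦ ∫_S f(s′) P₂(s,ds′) again belongs to D; and (b) P₂(s,·) ⪰_D P₁(s,·) for every s ∈ S, i.e., ∫_S f(s′) P₂(s,ds′) ≥ ∫_S f(s′) P₁(s,ds′) for all f ∈ D and all s ∈ S. Then μ₂ᵗ ⪰_D μ₁ᵗ for every t ∈ ℕ, i.e., ∫ f dμ₂ᵗ ≥ ∫ f dμ₁ᵗ for all f ∈ D. -/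
set_option autoImplicit false

open MeasureTheory

/-- The sequence of state distributions induced by a Markov kernel `P` and an
initial state `s0`: `iterDist P s0 0 = δ_{s0}` (the state distribution in period 1)
and `iterDist P s0 (t+1) = (iterDist P s0 t).bind P`, i.e.
`μ^{t+1}(B) = ∫ P(s,B) μ^t(ds)`. -/
noncomputable def iterDist {α : Type*} [MeasurableSpace α]
    (P : α → Measure α) (s0 : α) : ℕ → Measure α
  | 0 => Measure.dirac s0
  | t + 1 => (iterDist P s0 t).bind P

/-- The state distributions of a Markov kernel are probability measures. -/
theorem isProbabilityMeasure_iterDist {α : Type*} [MeasurableSpace α] {P : α → Measure α}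
    (hP : Measurable P) (hprob : ∀ s, IsProbabilityMeasure (P s)) (s0 : α) (t : ℕ) :
    IsProbabilityMeasure (iterDist P s0 t) := by
  induction t with
  | zero => exact Measure.dirac.isProbabilityMeasure
  | succ t ih =>
    exact isProbabilityMeasure_bind hP.aemeasurable (.of_forall hprob)

theorem integrable_of_measurable_of_abs_le {α : Type*} [MeasurableSpace α] {μ : Measure α}
    [IsFiniteMeasure μ] {f : α → ℝ} (hf : Measurable f) (hb : ∃ C : ℝ, ∀ x, |f x| ≤ C) :
    Integrable f μ :=
  let ⟨C, hC⟩ := hb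
  .of_bound hf.aestronglyMeasurable C (.of_forall hC)

/-- Integrating a bounded measurable function against the next state distribution. -/
theorem integral_iterDist_succ {α : Type*} [MeasurableSpace α] {P : α → Measure α}
    (hP : Measurable P) (hprob : ∀ s, IsProbabilityMeasure (P s)) (s0 : α) (t : ℕ)
    {f : α → ℝ} (hf : Measurable f) (hb : ∃ C : ℝ, ∀ x, |f x| ≤ C) :
    ∫ x, f x ∂(iterDist P s0 (t + 1)) = ∫ s, ∫ x, f x ∂(P s) ∂(iterDist P s0 t) := by
  have := isProbabilityMeasure_iterDist hP hprob s0 (t + 1)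
  have hcomp : iterDist P s0 (t + 1) =
      ProbabilityTheory.Kernel.comp ⟨P, hP⟩
        (ProbabilityTheory.Kernel.const Unit (iterDist P s0 t)) () :=
    Measure.comp_eq_comp_const_apply (κ := ⟨P, hP⟩)
  have hint : Integrable f (iterDist P s0 (t + 1)) := integrable_of_measurable_of_abs_le hf hb
  rw [hcomp] at hint ⊢
  exact ProbabilityTheory.Kernel.integral_comp hint

/-- Integrating against a Markov kernel preserves integrability of bounded measurable functions. -/
theorem integrable_integral_markov {α : Type*} [MeasurableSpace α] {P : α → Measure α}
    (hP : Measurable P) (hprob : ∀ s, IsProbabilityMeasure (P s)) {μ : Measure α}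
    [IsFiniteMeasure μ] {f : α → ℝ} (hf : Measurable f) (hb : ∃ C : ℝ, ∀ x, |f x| ≤ C) :
    Integrable (fun s => ∫ x, f x ∂(P s)) μ := by
  obtain ⟨C, hC⟩ := hb
  have hm : StronglyMeasurable (fun s => ∫ x, f x ∂(P s)) :=
    hf.stronglyMeasurable.integral_kernel (κ := ⟨P, hP⟩)
  refine .of_bound hm.aestronglyMeasurable C (.of_forall fun s => ?_)
  simpa using norm_integral_le_of_norm_le_const (μ := P s) (f := f) (.of_forall hC)

/-- Theorem 1: if `P₂` is `D`-preserving and `P₂(s,·) ⪰_D P₁(s,·)` for all `s ∈ S`,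
then `μ₂ᵗ ⪰_D μ₁ᵗ` for all `t`. -/
theorem stochastic_comparative_statics_general
    {n : ℕ} (S : Set (Fin n → ℝ)) (hS : MeasurableSet S)
    (D : Set (S → ℝ))
    (hD : ∀ f ∈ D, Measurable f ∧ ∃ C : ℝ, ∀ x, |f x| ≤ C)
    (P₁ P₂ : S → Measure S)
    (hP₁meas : Measurable P₁) (hP₂meas : Measurable P₂)
    (hP₁prob : ∀ s, IsProbabilityMeasure (P₁ s))
    (hP₂prob : ∀ s, IsProbabilityMeasure (P₂ s))
    (s1 : S)
    (hpres : ∀ f ∈ D, (fun s => ∫ x, f x ∂(P₂ s)) ∈ D)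
    (hdom : ∀ f ∈ D, ∀ s : S, ∫ x, f x ∂(P₂ s) ≥ ∫ x, f x ∂(P₁ s)) :
    ∀ t : ℕ, ∀ f ∈ D,
      ∫ x, f x ∂(iterDist P₂ s1 t) ≥ ∫ x, f x ∂(iterDist P₁ s1 t) := by
  intro t
  induction t with
  | zero => exact fun f _ => le_rfl
  | succ t ih =>
    intro f hf
    obtain ⟨hfm, hfb⟩ := hD f hf
    have := isProbabilityMeasure_iterDist hP₁meas hP₁prob s1 t
    rw [integral_iterDist_succ hP₁meas hP₁prob s1 t hfm hfb,
      integral_iterDist_succ hP₂meas hP₂prob s1 t hfm hfb]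
    calc ∫ s, ∫ x, f x ∂(P₁ s) ∂(iterDist P₁ s1 t)
        ≤ ∫ s, ∫ x, f x ∂(P₂ s) ∂(iterDist P₁ s1 t) :=
          integral_mono (integrable_integral_markov hP₁meas hP₁prob hfm hfb)
            (integrable_integral_markov hP₂meas hP₂prob hfm hfb) (hdom f hf)
      _ ≤ ∫ s, ∫ x, f x ∂(P₂ s) ∂(iterDist P₂ s1 t) := ih _ (hpres f hf)
end

section
/- Let p be a monotone transition probability function and g : S → A a bounded, measurable, increasing policy function. Let s₂(1) ≥ s₁(1) be two initial states and let μᵢᵗ be the state distributions induced by the kernel P(s,·) = p(s,g(s),·) from initial state sᵢ(1). Then ∫_S g dμ₂ᵗ ≥ ∫_S g dμ₁ᵗ for all t ∈ ℕ. -/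
set_option autoImplicit false

open MeasureTheory

/-- The state distributions induced by a Markov kernel are probability measures. -/
theorem isProbabilityMeasure_iterDist_s2 {α : Type*} [MeasurableSpace α]
    (κ : ProbabilityTheory.Kernel α α) [ProbabilityTheory.IsMarkovKernel κ] (x : α) (t : ℕ) :
    IsProbabilityMeasure (iterDist κ x t) := by
  induction t with
  | zero => exact Measure.dirac.isProbabilityMeasure
  | succ t ih => exact inferInstanceAs (IsProbabilityMeasure ((iterDist κ x t).bind κ))

/-- A Markov kernel preserving bounded measurable increasing functions induces state
distributions that are stochastically increasing in the initial state. -/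
theorem monotone_integral_iterDist {α : Type*} [MeasurableSpace α] [Preorder α]
    (κ : ProbabilityTheory.Kernel α α) [ProbabilityTheory.IsMarkovKernel κ]
    (hκ : ∀ f : α → ℝ, Measurable f → Monotone f → (∃ C : ℝ, ∀ x, |f x| ≤ C) →
      Monotone fun x => ∫ y, f y ∂κ x)
    {f : α → ℝ} (hf : Measurable f) (hmono : Monotone f) (hbdd : ∃ C : ℝ, ∀ x, |f x| ≤ C)
    (t : ℕ) : Monotone fun x => ∫ y, f y ∂(iterDist κ x t) := by
  induction t generalizing f with
  | zero =>
    simpa [iterDist, integral_dirac' _ _ hf.stronglyMeasurable] using hmono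
  | succ t ih =>
    obtain ⟨C, hC⟩ := hbdd
    have hstep : ∀ x, ∫ y, f y ∂(iterDist κ x (t + 1)) =
        ∫ z, ∫ y, f y ∂κ z ∂(iterDist κ x t) := fun x => by
      have := isProbabilityMeasure_iterDist_s2 κ x (t + 1)
      exact ProbabilityTheory.Kernel.integral_comp (η := κ) (a := ())
        (κ := ProbabilityTheory.Kernel.const Unit (iterDist κ x t))
        (Integrable.of_bound (μ := iterDist κ x (t + 1)) hf.aestronglyMeasurable C (.of_forall hC))
    simp only [hstep]
    refine ih hf.stronglyMeasurable.integral_kernel.measurable (hκ f hf hmono ⟨C, hC⟩)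
      ⟨C, fun x => ?_⟩
    simpa using norm_integral_le_of_norm_le_const (μ := κ x) (f := f) (.of_forall hC)

/-- Corollary 2: if the policy function `g` is increasing in the state and the
transition probability function `p` is monotone, then a higher initial state leads
to higher expected decisions in every period. -/
theorem scs_in_initial_state
    {n : ℕ} (S : Set (Fin n → ℝ)) (hS : MeasurableSet S)
    (A : Set ℝ)
    (p : S → A → Measure S)
    (hpmeas : Measurable fun sa : S × A => p sa.1 sa.2)
    (hpprob : ∀ s a, IsProbabilityMeasure (p s a))
    -- `p` is monotone
    (hpmono : ∀ f : S → ℝ, Measurable f → Monotone f → (∃ C : ℝ, ∀ x, |f x| ≤ C) →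
      Monotone fun sa : S × A => ∫ x, f x ∂(p sa.1 sa.2))
    (g : S → A)
    -- `g` is a bounded measurable increasing policy function
    (hgmeas : Measurable fun s => (g s : ℝ))
    (hgbdd : ∃ C : ℝ, ∀ s, |(g s : ℝ)| ≤ C)
    (hgmono : Monotone g)
    (s₁ s₂ : S) (hs : s₁ ≤ s₂) :
    ∀ t : ℕ,
      ∫ s, (g s : ℝ) ∂(iterDist (fun s => p s (g s)) s₂ t) ≥
        ∫ s, (g s : ℝ) ∂(iterDist (fun s => p s (g s)) s₁ t) := by
  have hg : Measurable g := hgmeas.subtype_mk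
  let κ : ProbabilityTheory.Kernel S S :=
    ⟨fun s => p s (g s), hpmeas.comp (measurable_id.prodMk hg)⟩
  have : ProbabilityTheory.IsMarkovKernel κ := ⟨fun s => hpprob s (g s)⟩
  have hκ : ∀ f : S → ℝ, Measurable f → Monotone f → (∃ C : ℝ, ∀ x, |f x| ≤ C) →
      Monotone fun s => ∫ x, f x ∂κ s := fun f hf hmono hbdd =>
    (hpmono f hf hmono hbdd).comp (monotone_id.prodMk hgmono)
  exact fun t => monotone_integral_iterDist κ hκ hgmeas (fun _ _ h => hgmono h) hgbdd t hs
end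

section
/- Let p be a monotone transition probability function and r : S × A → ℝ measurable. Let f : S × (0,1) → ℝ be such that f(·,β) is bounded, measurable and increasing in s for each β ∈ (0,1), and f has increasing differences in (s,β). Define h(s,a,β) = r(s,a) + β ∫_S f(s′,β) p(s,a,ds′). Then for every fixed s ∈ S the function h has increasing differences in (a,β), and for every fixed a ∈ A the function h has increasing differences in (s,β). -/
set_option autoImplicit false

open MeasureTheory

/-- `hval p r f β s a = r(s,a) + β ∫ f(s',β) p(s,a,ds')`. -/
noncomputable def hval {S A : Type*} [MeasurableSpace S]
    (p : S → A → Measure S) (r : S → A → ℝ) (f : S → ℝ → ℝ)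
    (β : ℝ) (s : S) (a : A) : ℝ :=
  r s a + β * ∫ x, f x β ∂(p s a)

/-- Integrating against a monotone transition probability preserves increasing differences in
the parameter. -/
theorem integral_sub_le_integral_sub_of_increasing_differences {S X : Type*} [MeasurableSpace S]
    [Preorder S] [Preorder X] (q : X → Measure S) [∀ x, IsProbabilityMeasure (q x)]
    (hq : ∀ f : S → ℝ, Measurable f → Monotone f → (∃ C : ℝ, ∀ s, |f s| ≤ C) →
      Monotone fun x => ∫ s, f s ∂(q x))
    {g₁ g₂ : S → ℝ} (hg₁ : Measurable g₁) (hb₁ : ∃ C : ℝ, ∀ s, |g₁ s| ≤ C)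
    (hg₂ : Measurable g₂) (hb₂ : ∃ C : ℝ, ∀ s, |g₂ s| ≤ C)
    (hmono : Monotone fun s => g₂ s - g₁ s) {x₁ x₂ : X} (hx : x₁ ≤ x₂) :
    ∫ s, g₁ s ∂(q x₂) - ∫ s, g₁ s ∂(q x₁) ≤ ∫ s, g₂ s ∂(q x₂) - ∫ s, g₂ s ∂(q x₁) := by
  obtain ⟨C₁, hC₁⟩ := hb₁
  obtain ⟨C₂, hC₂⟩ := hb₂
  have hint₁ (x : X) : Integrable g₁ (q x) :=
    .of_bound hg₁.aestronglyMeasurable C₁ (.of_forall hC₁)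
  have hint₂ (x : X) : Integrable g₂ (q x) :=
    .of_bound hg₂.aestronglyMeasurable C₂ (.of_forall hC₂)
  have h := hq _ (hg₂.sub hg₁) hmono
    ⟨C₂ + C₁, fun s => (abs_sub _ _).trans (add_le_add (hC₂ s) (hC₁ s))⟩ hx
  simp only [Pi.sub_apply, integral_sub (hint₂ _) (hint₁ _)] at h
  linarith

/-- If `p` is monotone and `f(·,β)` is bounded, measurable and increasing with
increasing differences in `(s,β)`, then `h(s,a,β) = r(s,a) + β ∫ f(s',β) p(s,a,ds')`
has increasing differences in `(a,β)` for each fixed `s`, and increasing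
differences in `(s,β)` for each fixed `a`. -/
theorem h_has_increasing_differences_in_discount
    {n : ℕ} (S : Set (Fin n → ℝ)) (hS : MeasurableSet S)
    (A : Set ℝ)
    (p : S → A → Measure S)
    (hpmeas : Measurable fun sa : S × A => p sa.1 sa.2)
    (hpprob : ∀ s a, IsProbabilityMeasure (p s a))
    -- `p` is monotone
    (hpmono : ∀ f : S → ℝ, Measurable f → Monotone f → (∃ C : ℝ, ∀ x, |f x| ≤ C) →
      Monotone fun sa : S × A => ∫ x, f x ∂(p sa.1 sa.2))
    (r : S → A → ℝ)
    (hrmeas : Measurable fun sa : S × A => r sa.1 sa.2)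
    (f : S → ℝ → ℝ)
    -- `f(·,β)` is bounded, measurable and increasing in `s` for each `β ∈ (0,1)`
    (hf : ∀ β ∈ Set.Ioo (0:ℝ) 1, Measurable (fun s => f s β) ∧
      Monotone (fun s => f s β) ∧ ∃ C : ℝ, ∀ s, |f s β| ≤ C)
    -- `f` has increasing differences in `(s,β)`
    (hfid : ∀ s₁ s₂ : S, s₁ ≤ s₂ → ∀ β₁ ∈ Set.Ioo (0:ℝ) 1, ∀ β₂ ∈ Set.Ioo (0:ℝ) 1,
      β₁ ≤ β₂ → f s₂ β₂ - f s₂ β₁ ≥ f s₁ β₂ - f s₁ β₁) :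
    -- `h` has increasing differences in `(a,β)` for each fixed `s`
    (∀ s : S, ∀ a₁ a₂ : A, a₁ ≤ a₂ → ∀ β₁ ∈ Set.Ioo (0:ℝ) 1, ∀ β₂ ∈ Set.Ioo (0:ℝ) 1,
      β₁ ≤ β₂ →
      hval p r f β₂ s a₂ - hval p r f β₂ s a₁ ≥
        hval p r f β₁ s a₂ - hval p r f β₁ s a₁) ∧
    -- `h` has increasing differences in `(s,β)` for each fixed `a`
    (∀ a : A, ∀ s₁ s₂ : S, s₁ ≤ s₂ → ∀ β₁ ∈ Set.Ioo (0:ℝ) 1, ∀ β₂ ∈ Set.Ioo (0:ℝ) 1,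
      β₁ ≤ β₂ →
      hval p r f β₂ s₂ a - hval p r f β₁ s₂ a ≥
        hval p r f β₂ s₁ a - hval p r f β₁ s₁ a) := by
  have key : ∀ x₁ x₂ : S × A, x₁ ≤ x₂ → ∀ β₁ ∈ Set.Ioo (0:ℝ) 1, ∀ β₂ ∈ Set.Ioo (0:ℝ) 1,
      β₁ ≤ β₂ →
      hval p r f β₁ x₂.1 x₂.2 - hval p r f β₁ x₁.1 x₁.2 ≤
        hval p r f β₂ x₂.1 x₂.2 - hval p r f β₂ x₁.1 x₁.2 := by
    intro x₁ x₂ hx β₁ hβ₁ β₂ hβ₂ hβ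
    obtain ⟨hm₁, hmono₁, hb₁⟩ := hf β₁ hβ₁
    obtain ⟨hm₂, -, hb₂⟩ := hf β₂ hβ₂
    have hdiff := integral_sub_le_integral_sub_of_increasing_differences
      (fun x : S × A => p x.1 x.2) hpmono hm₁ hb₁ hm₂ hb₂
      (fun s t hst => hfid s t hst β₁ hβ₁ β₂ hβ₂ hβ) hx
    have hnonneg := sub_nonneg.2 (hpmono _ hm₁ hmono₁ hb₁ hx)
    have hmul := mul_le_mul hβ hdiff hnonneg hβ₂.1.le
    simp only [hval]
    linarith
  refine ⟨fun s a₁ a₂ ha β₁ hβ₁ β₂ hβ₂ hβ => ?_, fun a s₁ s₂ hs β₁ hβ₁ β₂ hβ₂ hβ => ?_⟩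
  · exact key (s, a₁) (s, a₂) ⟨le_rfl, ha⟩ β₁ hβ₁ β₂ hβ₂ hβ
  · have h := key (s₁, a) (s₂, a) ⟨hs, le_rfl⟩ β₁ hβ₁ β₂ hβ₂ hβ
    simp only at h
    linarith
end

section
/- In the dynamic pricing model with a reference effect and an uncertain memory factor, the optimal pricing policy g(s) is increasing in the reference price s. -/
set_option autoImplicit false

open MeasureTheory

/-- A solution of the discounted dynamic program on the state set `S` with
feasible-action correspondence `Γ` and Bellman functional `H` (`H f s a = h(s,a,f)`):
`V` is the value function, a fixed point of the Bellman operator `T` with the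
maximum attained; `W t = Tᵗ0` are the Bellman iterates of the zero function and
converge pointwise to `V`; `g(s) = max{a ∈ Γ(s) : h(s,a,V) = V(s)}` is the policy
function. -/
structure DPSolution {σ : Type*} (S : Set σ) (Γ : σ → Set ℝ)
    (H : (σ → ℝ) → σ → ℝ → ℝ) where
  V : σ → ℝ
  g : σ → ℝ
  W : ℕ → σ → ℝ
  W_zero : W 0 = fun _ => 0
  bellman : ∀ s ∈ S, IsGreatest ((fun a => H V s a) '' Γ s) (V s)
  iterate : ∀ t, ∀ s ∈ S, IsGreatest ((fun a => H (W t) s a) '' Γ s) (W (t + 1) s)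
  tendstoV : ∀ s ∈ S, Filter.Tendsto (fun t => W t s) Filter.atTop (nhds (V s))
  gmax : ∀ s ∈ S, IsGreatest {a ∈ Γ s | H V s a = V s} (g s)

theorem ConvexOn.map_add_add_map_add_le {f : ℝ → ℝ} {K : Set ℝ} (hf : ConvexOn ℝ K f)
    {x δ ε : ℝ} (hδ : 0 ≤ δ) (hε : 0 ≤ ε) (hx : x ∈ K) (hy : x + δ + ε ∈ K) :
    f (x + δ) + f (x + ε) ≤ f x + f (x + δ + ε) := by
  rcases (add_nonneg hδ hε).eq_or_lt' with h | h
  · obtain rfl : δ = 0 := by linarith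
    obtain rfl : ε = 0 := by linarith
    simp
  · have hsum : ε / (δ + ε) + δ / (δ + ε) = 1 := by field_simp; ring
    have hp : 0 ≤ ε / (δ + ε) := by positivity
    have hq : 0 ≤ δ / (δ + ε) := by positivity
    have h₁ := hf.2 hx hy hp hq hsum
    have h₂ := hf.2 hx hy hq hp (by linarith)
    have e₁ : (ε / (δ + ε)) • x + (δ / (δ + ε)) • (x + δ + ε) = x + δ := by
      simp only [smul_eq_mul]; field_simp; ring
    have e₂ : (δ / (δ + ε)) • x + (ε / (δ + ε)) • (x + δ + ε) = x + ε := by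
      simp only [smul_eq_mul]; field_simp; ring
    rw [e₁] at h₁
    rw [e₂] at h₂
    simp only [smul_eq_mul] at h₁ h₂
    linear_combination h₁ + h₂ + (f x + f (x + δ + ε)) * hsum

theorem mix_mem_Icc {lo hi s a γ : ℝ} (hs : s ∈ Set.Icc lo hi) (ha : a ∈ Set.Icc lo hi)
    (hγ : γ ∈ Set.Icc (0 : ℝ) 1) : γ * s + (1 - γ) * a ∈ Set.Icc lo hi :=
  convex_Icc lo hi hs ha hγ.1 (sub_nonneg.2 hγ.2) (by ring)

section Mixture

variable {lo hi : ℝ} {f : ℝ → ℝ} {v : Measure ℝ}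

theorem integrable_mix [IsFiniteMeasure v] (hv : ∀ᵐ γ ∂v, γ ∈ Set.Icc (0 : ℝ) 1)
    (hf : MonotoneOn f (Set.Icc lo hi)) {s a : ℝ}
    (hs : s ∈ Set.Icc lo hi) (ha : a ∈ Set.Icc lo hi) :
    Integrable (fun γ => f (γ * s + (1 - γ) * a)) v := by
  have hle : lo ≤ hi := hs.1.trans hs.2
  set F : ℝ → ℝ := fun x => f (Set.projIcc lo hi hle x) with hF
  have hmono : Monotone F := fun x y hxy =>
    hf (Set.projIcc lo hi hle x).2 (Set.projIcc lo hi hle y).2 (Set.monotone_projIcc hle hxy)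
  have hint : Integrable (fun γ => F (γ * s + (1 - γ) * a)) v := by
    refine Integrable.of_mem_Icc (f lo) (f hi) ?_ (Filter.Eventually.of_forall fun γ => ?_)
    · exact (hmono.measurable.comp (by fun_prop)).aemeasurable
    · have hz := (Set.projIcc lo hi hle (γ * s + (1 - γ) * a)).2
      exact ⟨hf (Set.left_mem_Icc.2 hle) hz hz.1, hf hz (Set.right_mem_Icc.2 hle) hz.2⟩
  refine hint.congr ?_
  filter_upwards [hv] with γ hγ
  simp only [hF, Set.projIcc_of_mem hle (mix_mem_Icc hs ha hγ)]

theorem monotoneOn_integral_mix [IsFiniteMeasure v] (hv : ∀ᵐ γ ∂v, γ ∈ Set.Icc (0 : ℝ) 1)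
    (hf : MonotoneOn f (Set.Icc lo hi)) {a : ℝ} (ha : a ∈ Set.Icc lo hi) :
    MonotoneOn (fun s => ∫ γ, f (γ * s + (1 - γ) * a) ∂v) (Set.Icc lo hi) := by
  intro s hs t ht hst
  refine integral_mono_ae (integrable_mix hv hf hs ha) (integrable_mix hv hf ht ha) ?_
  filter_upwards [hv] with γ hγ
  refine hf (mix_mem_Icc hs ha hγ) (mix_mem_Icc ht ha hγ) ?_
  have := mul_le_mul_of_nonneg_left hst hγ.1
  linarith

theorem convexOn_integral_mix [IsFiniteMeasure v] (hv : ∀ᵐ γ ∂v, γ ∈ Set.Icc (0 : ℝ) 1)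
    (hf : MonotoneOn f (Set.Icc lo hi)) (hc : ConvexOn ℝ (Set.Icc lo hi) f)
    {a : ℝ} (ha : a ∈ Set.Icc lo hi) :
    ConvexOn ℝ (Set.Icc lo hi) (fun s => ∫ γ, f (γ * s + (1 - γ) * a) ∂v) := by
  refine ⟨convex_Icc lo hi, fun s hs t ht p q hp hq hpq => ?_⟩
  have his := integrable_mix hv hf hs ha
  have hit := integrable_mix hv hf ht ha
  simp only [smul_eq_mul]
  rw [← integral_const_mul, ← integral_const_mul,
    ← integral_add (his.const_mul p) (hit.const_mul q)]
  refine integral_mono_ae (integrable_mix hv hf (convex_Icc lo hi hs ht hp hq hpq) ha)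
    ((his.const_mul p).add (hit.const_mul q)) ?_
  filter_upwards [hv] with γ hγ
  have h := hc.2 (mix_mem_Icc hs ha hγ) (mix_mem_Icc ht ha hγ) hp hq hpq
  have e : p • (γ * s + (1 - γ) * a) + q • (γ * t + (1 - γ) * a)
      = γ * (p * s + q * t) + (1 - γ) * a := by
    simp only [smul_eq_mul]
    linear_combination ((1 - γ) * a) * hpq
  rw [e] at h
  simpa only [smul_eq_mul] using h

theorem integral_mix_increasing_differences [IsFiniteMeasure v]
    (hv : ∀ᵐ γ ∂v, γ ∈ Set.Icc (0 : ℝ) 1)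
    (hf : MonotoneOn f (Set.Icc lo hi)) (hc : ConvexOn ℝ (Set.Icc lo hi) f)
    {s t a b : ℝ} (hs : s ∈ Set.Icc lo hi) (ht : t ∈ Set.Icc lo hi)
    (ha : a ∈ Set.Icc lo hi) (hb : b ∈ Set.Icc lo hi) (hst : s ≤ t) (hab : a ≤ b) :
    (∫ γ, f (γ * t + (1 - γ) * a) ∂v) + ∫ γ, f (γ * s + (1 - γ) * b) ∂v
      ≤ (∫ γ, f (γ * s + (1 - γ) * a) ∂v) + ∫ γ, f (γ * t + (1 - γ) * b) ∂v := by
  have hta := integrable_mix hv hf ht ha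
  have hsb := integrable_mix hv hf hs hb
  have hsa := integrable_mix hv hf hs ha
  have htb := integrable_mix hv hf ht hb
  rw [← integral_add hta hsb, ← integral_add hsa htb]
  refine integral_mono_ae (hta.add hsb) (hsa.add htb) ?_
  filter_upwards [hv] with γ hγ
  have e₁ : γ * s + (1 - γ) * a + γ * (t - s) = γ * t + (1 - γ) * a := by ring
  have e₂ : γ * s + (1 - γ) * a + (1 - γ) * (b - a) = γ * s + (1 - γ) * b := by ring
  have e₃ : γ * t + (1 - γ) * a + (1 - γ) * (b - a) = γ * t + (1 - γ) * b := by ring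
  have h := hc.map_add_add_map_add_le (x := γ * s + (1 - γ) * a)
    (mul_nonneg hγ.1 (sub_nonneg.2 hst))
    (mul_nonneg (sub_nonneg.2 hγ.2) (sub_nonneg.2 hab)) (mix_mem_Icc hs ha hγ)
    (by rw [e₁, e₃]; exact mix_mem_Icc ht hb hγ)
  rwa [e₁, e₂, e₃] at h

end Mixture

section Maximum

variable {A : Set ℝ} {S : Set ℝ} {h : ℝ → ℝ → ℝ} {M : ℝ → ℝ}

theorem MonotoneOn.of_isGreatest_image (hM : ∀ s ∈ S, IsGreatest ((fun a => h s a) '' A) (M s))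
    (hh : ∀ a ∈ A, MonotoneOn (fun s => h s a) S) : MonotoneOn M S := by
  intro s hs t ht hst
  obtain ⟨a, ha, hMa⟩ := (hM s hs).1
  rw [← hMa]
  exact (hh a ha hs ht hst).trans ((hM t ht).2 ⟨a, ha, rfl⟩)

theorem ConvexOn.of_isGreatest_image (hS : Convex ℝ S)
    (hM : ∀ s ∈ S, IsGreatest ((fun a => h s a) '' A) (M s))
    (hh : ∀ a ∈ A, ConvexOn ℝ S (fun s => h s a)) : ConvexOn ℝ S M := by
  refine ⟨hS, fun s hs t ht p q hp hq hpq => ?_⟩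
  obtain ⟨a, ha, hMa⟩ := (hM _ (hS hs ht hp hq hpq)).1
  rw [← hMa]
  refine ((hh a ha).2 hs ht hp hq hpq).trans ?_
  exact add_le_add (smul_le_smul_of_nonneg_left ((hM s hs).2 ⟨a, ha, rfl⟩) hp)
    (smul_le_smul_of_nonneg_left ((hM t ht).2 ⟨a, ha, rfl⟩) hq)

end Maximum

/-- Proposition 2(i) (dynamic pricing with a reference effect and an uncertain
memory factor): the optimal pricing policy `g(s)` is increasing in the reference
price `s`. -/
theorem optimal_price_increasing_in_reference_price
    (lo hi abar : ℝ) (hlo : lo ≤ 0) (habar : 0 ≤ abar) (hhi : abar ≤ hi)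
    -- the state space is a compact interval `S` containing `[0,ā]`;
    -- the action space is `A = [0,ā]`
    (D : ℝ → ℝ → ℝ)
    (hDcont : Continuous fun q : ℝ × ℝ => D q.1 q.2)
    (hDnonneg : ∀ s ∈ Set.Icc lo hi, ∀ a ∈ Set.Icc 0 abar, 0 ≤ D s a)
    (hDdec : ∀ s ∈ Set.Icc lo hi, AntitoneOn (fun a => D s a) (Set.Icc 0 abar))
    (hDinc : ∀ a ∈ Set.Icc 0 abar, MonotoneOn (fun s => D s a) (Set.Icc lo hi))
    (hDconv : ∀ a ∈ Set.Icc 0 abar, ConvexOn ℝ (Set.Icc lo hi) (fun s => D s a))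
    (hDid : ∀ s₁ ∈ Set.Icc lo hi, ∀ s₂ ∈ Set.Icc lo hi,
      ∀ a₁ ∈ Set.Icc 0 abar, ∀ a₂ ∈ Set.Icc 0 abar, s₁ ≤ s₂ → a₁ ≤ a₂ →
      D s₂ a₂ - D s₂ a₁ ≥ D s₁ a₂ - D s₁ a₁)
    -- the memory factor is a random variable on `[0,1]` with law `v`
    (v : Measure ℝ) (hv : IsProbabilityMeasure v) (hvsupp : v (Set.Icc 0 1) = 1)
    (β : ℝ) (hβ : β ∈ Set.Ioo (0:ℝ) 1)
    -- a solution of the dynamic program with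
    -- `h(s,a,f) = a·D(s,a) + β ∫ f(γs + (1−γ)a) v(dγ)`
    (sol : DPSolution (Set.Icc lo hi) (fun _ => Set.Icc 0 abar)
      (fun f s a => a * D s a + β * ∫ γ, f (γ * s + (1 - γ) * a) ∂v)) :
    MonotoneOn sol.g (Set.Icc lo hi) := by
  have hv01 : ∀ᵐ γ ∂v, γ ∈ Set.Icc (0 : ℝ) 1 :=
    (mem_ae_iff_prob_eq_one measurableSet_Icc).2 hvsupp
  have hA : ∀ a ∈ Set.Icc 0 abar, a ∈ Set.Icc lo hi := fun a ha =>
    ⟨hlo.trans ha.1, ha.2.trans hhi⟩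
  have hW : ∀ n, MonotoneOn (sol.W n) (Set.Icc lo hi) ∧ ConvexOn ℝ (Set.Icc lo hi) (sol.W n) := by
    intro n
    induction n with
    | zero =>
      rw [sol.W_zero]
      exact ⟨monotoneOn_const, convexOn_const 0 (convex_Icc lo hi)⟩
    | succ n ih =>
      refine ⟨MonotoneOn.of_isGreatest_image (sol.iterate n) fun a ha => ?_,
        ConvexOn.of_isGreatest_image (convex_Icc lo hi) (sol.iterate n) fun a ha => ?_⟩
      · intro s hs t ht hst
        exact add_le_add (mul_le_mul_of_nonneg_left (hDinc a ha hs ht hst) ha.1)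
          (mul_le_mul_of_nonneg_left
            (monotoneOn_integral_mix hv01 ih.1 (hA a ha) hs ht hst) hβ.1.le)
      · exact ((hDconv a ha).smul ha.1).add
          ((convexOn_integral_mix hv01 ih.1 ih.2 (hA a ha)).smul hβ.1.le)
  have hVmono : MonotoneOn sol.V (Set.Icc lo hi) := fun s hs t ht hst =>
    le_of_tendsto_of_tendsto' (sol.tendstoV s hs) (sol.tendstoV t ht)
      fun n => (hW n).1 hs ht hst
  have hVconv : ConvexOn ℝ (Set.Icc lo hi) sol.V :=
    ⟨convex_Icc lo hi, fun s hs t ht p q hp hq hpq =>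
      le_of_tendsto_of_tendsto' (sol.tendstoV _ (convex_Icc lo hi hs ht hp hq hpq))
        (((sol.tendstoV s hs).const_smul p).add ((sol.tendstoV t ht).const_smul q))
        fun n => (hW n).2.2 hs ht hp hq hpq⟩
  intro s hs t ht hst
  by_contra! hlt
  obtain ⟨⟨hb, hbV⟩, -⟩ := sol.gmax s hs
  obtain ⟨⟨ha, haV⟩, hmax⟩ := sol.gmax t ht
  refine hlt.not_ge (hmax ⟨hb, le_antisymm ((sol.bellman t ht).2 ⟨_, hb, rfl⟩) ?_⟩)
  have hopt := (sol.bellman s hs).2 ⟨_, ha, rfl⟩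
  have hint := mul_le_mul_of_nonneg_left (integral_mix_increasing_differences hv01 hVmono hVconv
    hs ht (hA _ ha) (hA _ hb) hst hlt.le) hβ.1.le
  have hD₁ := mul_le_mul_of_nonneg_left (hDid s hs t ht _ ha _ hb hst hlt.le) hb.1
  have hD₂ := mul_le_mul_of_nonneg_left (hDinc _ ha hs ht hst) (sub_nonneg.2 hlt.le)
  dsimp only at hbV haV hopt hD₂ ⊢
  linarith
end

section
/- Let S ⊆ ℝ be compact. Let p₁, p₂ be transition probability functions with p₂ monotone and p₂ ⪰_st p₁, and let g₁, g₂ : S → A be bounded measurable policy functions with g₂ increasing and g₂(s) ≥ g₁(s) for all s ∈ S. Define the stationary-distribution operators Φᵢ(λ)(B) = ∫_S pᵢ(s,gᵢ(s),B) λ(ds) on probability measures λ on S. Then λ₂ ⪰_st λ₁ implies Φ₂(λ₂) ⪰_st Φ₁(λ₁); i.e., the operator (λ,p) ↦ Φ(λ,p) is increasing with respect to first-order stochastic dominance. -/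
set_option autoImplicit false

open MeasureTheory

/-- Fubini for `Measure.bind`, for a bounded integrand and almost surely probability measures. -/
theorem integral_bind_of_bounded {α β : Type*} [MeasurableSpace α] [MeasurableSpace β]
    {μ : Measure α} [IsFiniteMeasure μ] {q : α → Measure β} (hq : Measurable q)
    (hprob : ∀ᵐ x ∂μ, IsProbabilityMeasure (q x))
    {f : β → ℝ} (hf : Measurable f) {C : ℝ} (hC : ∀ y, |f y| ≤ C) :
    ∫ y, f y ∂(μ.bind q) = ∫ x, ∫ y, f y ∂(q x) ∂μ := by
  have hmass : μ.bind q Set.univ = μ Set.univ := by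
    rw [Measure.bind_apply .univ hq.aemeasurable, ← lintegral_one]
    exact lintegral_congr_ae (hprob.mono fun x hx => hx.measure_univ)
  have : IsFiniteMeasure (μ.bind q) := ⟨hmass ▸ measure_lt_top μ _⟩
  have hint : Integrable f (μ.bind q) :=
    .of_bound hf.aestronglyMeasurable C (ae_of_all _ hC)
  let κ : ProbabilityTheory.Kernel α β := ⟨q, hq⟩
  exact ProbabilityTheory.Kernel.integral_comp (η := κ)
    (κ := ProbabilityTheory.Kernel.const Unit μ) (a := ()) hint

theorem measurable_integral_of_measurable {α β : Type*} [MeasurableSpace α] [MeasurableSpace β]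
    {q : α → Measure β} (hq : Measurable q) {f : β → ℝ} (hf : Measurable f) :
    Measurable fun x => ∫ y, f y ∂(q x) :=
  let κ : ProbabilityTheory.Kernel α β := ⟨q, hq⟩
  (hf.stronglyMeasurable.integral_kernel (κ := κ)).measurable

theorem abs_integral_le_of_bounded {β : Type*} [MeasurableSpace β] {μ : Measure β}
    [IsProbabilityMeasure μ] {f : β → ℝ} {C : ℝ} (hC : ∀ y, |f y| ≤ C) :
    |∫ y, f y ∂μ| ≤ C := by
  simpa using norm_integral_le_of_norm_le_const (μ := μ) (f := f) (ae_of_all _ hC)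

/-- Key step of Proposition 4(i): the stationary-distribution operator
`Φ(λ,p)(B) = ∫ p(s,g(s,p),B) λ(ds)` is increasing with respect to first-order
stochastic dominance. -/
theorem stationary_operator_monotone_st
    (S : Set ℝ) (hScomp : IsCompact S) (hSmeas : MeasurableSet S)
    (A : Set ℝ)
    (p₁ p₂ : ℝ → ℝ → Measure ℝ)
    (hp₁meas : Measurable fun sa : ℝ × ℝ => p₁ sa.1 sa.2)
    (hp₂meas : Measurable fun sa : ℝ × ℝ => p₂ sa.1 sa.2)
    (hp₁prob : ∀ s ∈ S, ∀ a ∈ A, IsProbabilityMeasure (p₁ s a) ∧ p₁ s a S = 1)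
    (hp₂prob : ∀ s ∈ S, ∀ a ∈ A, IsProbabilityMeasure (p₂ s a) ∧ p₂ s a S = 1)
    -- `p₂` is monotone
    (hp₂mono : ∀ f : ℝ → ℝ, Measurable f → MonotoneOn f S →
      (∃ C : ℝ, ∀ x, |f x| ≤ C) →
      MonotoneOn (fun sa : ℝ × ℝ => ∫ x, f x ∂(p₂ sa.1 sa.2)) (S ×ˢ A))
    -- `p₂ ⪰_st p₁`
    (hst : ∀ f : ℝ → ℝ, Measurable f → MonotoneOn f S →
      (∃ C : ℝ, ∀ x, |f x| ≤ C) →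
      ∀ s ∈ S, ∀ a ∈ A, ∫ x, f x ∂(p₂ s a) ≥ ∫ x, f x ∂(p₁ s a))
    -- bounded measurable policy functions with values in `A`
    (g₁ g₂ : ℝ → ℝ)
    (hg₁meas : Measurable g₁) (hg₂meas : Measurable g₂)
    (hg₁bdd : ∃ C : ℝ, ∀ s, |g₁ s| ≤ C) (hg₂bdd : ∃ C : ℝ, ∀ s, |g₂ s| ≤ C)
    (hg₁A : ∀ s ∈ S, g₁ s ∈ A) (hg₂A : ∀ s ∈ S, g₂ s ∈ A)
    -- `g₂` is increasing and `g₂ ≥ g₁` on `S`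
    (hg₂mono : MonotoneOn g₂ S)
    (hge : ∀ s ∈ S, g₂ s ≥ g₁ s)
    -- probability measures `λ₁, λ₂` on `S` with `λ₂ ⪰_st λ₁`
    (lam₁ lam₂ : Measure ℝ)
    (hlam₁prob : IsProbabilityMeasure lam₁) (hlam₂prob : IsProbabilityMeasure lam₂)
    (hlam₁supp : lam₁ S = 1) (hlam₂supp : lam₂ S = 1)
    (hlamst : ∀ f : ℝ → ℝ, Measurable f → MonotoneOn f S →
      (∃ C : ℝ, ∀ x, |f x| ≤ C) → ∫ x, f x ∂lam₂ ≥ ∫ x, f x ∂lam₁) :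
    -- then `Φ₂(λ₂) ⪰_st Φ₁(λ₁)`
    ∀ f : ℝ → ℝ, Measurable f → MonotoneOn f S → (∃ C : ℝ, ∀ x, |f x| ≤ C) →
      ∫ x, f x ∂(lam₂.bind fun s => p₂ s (g₂ s)) ≥
        ∫ x, f x ∂(lam₁.bind fun s => p₁ s (g₁ s)) := by
  intro f hf hfmono ⟨C, hC⟩
  have hq₁ : Measurable fun s => p₁ s (g₁ s) := hp₁meas.comp (measurable_id.prodMk hg₁meas)
  have hq₂ : Measurable fun s => p₂ s (g₂ s) := hp₂meas.comp (measurable_id.prodMk hg₂meas)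
  have hS₁ : ∀ᵐ s ∂lam₁, s ∈ S := (mem_ae_iff_prob_eq_one hSmeas).2 hlam₁supp
  have hS₂ : ∀ᵐ s ∂lam₂, s ∈ S := (mem_ae_iff_prob_eq_one hSmeas).2 hlam₂supp
  rw [integral_bind_of_bounded hq₁ (hS₁.mono fun s hs => (hp₁prob s hs _ (hg₁A s hs)).1) hf hC,
    integral_bind_of_bounded hq₂ (hS₂.mono fun s hs => (hp₂prob s hs _ (hg₂A s hs)).1) hf hC]
  have hC0 : 0 ≤ C := (abs_nonneg _).trans (hC 0)
  have hbound₁ : ∀ s ∈ S, |∫ x, f x ∂(p₁ s (g₁ s))| ≤ C := fun s hs =>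
    have := (hp₁prob s hs _ (hg₁A s hs)).1
    abs_integral_le_of_bounded hC
  -- The integral of `f` under the second policy, cut off outside `S` to be globally bounded.
  set F : ℝ → ℝ := S.indicator fun s => ∫ x, f x ∂(p₂ s (g₂ s)) with hF
  have hFS : ∀ s ∈ S, F s = ∫ x, f x ∂(p₂ s (g₂ s)) := fun s hs => Set.indicator_of_mem hs _
  have hFmeas : Measurable F := (measurable_integral_of_measurable hq₂ hf).indicator hSmeas
  have hFbound : ∀ s, |F s| ≤ C := by
    intro s
    by_cases hs : s ∈ S
    · have := (hp₂prob s hs _ (hg₂A s hs)).1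
      rw [hFS s hs]
      exact abs_integral_le_of_bounded hC
    · simpa [hF, hs] using hC0
  have hFmono : MonotoneOn F S := by
    intro s hs t ht hst
    rw [hFS s hs, hFS t ht]
    exact hp₂mono f hf hfmono ⟨C, hC⟩ (a := (s, g₂ s)) ⟨hs, hg₂A s hs⟩ (b := (t, g₂ t))
      ⟨ht, hg₂A t ht⟩ ⟨hst, hg₂mono hs ht hst⟩
  have hle : ∀ s ∈ S, ∫ x, f x ∂(p₁ s (g₁ s)) ≤ F s := by
    intro s hs
    rw [hFS s hs]
    exact (hst f hf hfmono ⟨C, hC⟩ s hs _ (hg₁A s hs)).trans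
      (hp₂mono f hf hfmono ⟨C, hC⟩ (a := (s, g₁ s)) ⟨hs, hg₁A s hs⟩ (b := (s, g₂ s))
        ⟨hs, hg₂A s hs⟩ ⟨le_rfl, hge s hs⟩)
  calc ∫ s, ∫ x, f x ∂(p₁ s (g₁ s)) ∂lam₁
      ≤ ∫ s, F s ∂lam₁ := integral_mono_ae
        (.of_bound (measurable_integral_of_measurable hq₁ hf).aestronglyMeasurable C
          (hS₁.mono hbound₁))
        (.of_bound hFmeas.aestronglyMeasurable C (ae_of_all _ hFbound)) (hS₁.mono hle)
    _ ≤ ∫ s, F s ∂lam₂ := hlamst F hFmeas hFmono ⟨C, hFbound⟩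
    _ = ∫ s, ∫ x, f x ∂(p₂ s (g₂ s)) ∂lam₂ := integral_congr_ae (hS₂.mono hFS)
end

section
/- Let S ⊆ ℝ be compact. Let p₁, p₂ be transition probability functions with p₂ monotone and convexity-preserving and p₂ ⪰_CX p₁, and let g₁, g₂ : S → A be bounded measurable policy functions with g₂ increasing and convex and g₂(s) ≥ g₁(s) for all s ∈ S. Define the stationary-distribution operators Φᵢ(λ)(B) = ∫_S pᵢ(s,gᵢ(s),B) λ(ds) on probability measures λ on S. Then λ₂ ⪰_ICX λ₁ implies Φ₂(λ₂) ⪰_ICX Φ₁(λ₁); i.e., the operator (λ,p) ↦ Φ(λ,p) is increasing with respect to the increasing convex order. -/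
set_option autoImplicit false

open MeasureTheory

/-- A measurable family of measures that are probability measures over a measurable set agrees on
that set with a Markov kernel. -/
theorem exists_isMarkovKernel_eqOn {α β : Type*} [MeasurableSpace α] [MeasurableSpace β]
    [Nonempty β] {S : Set α} (hS : MeasurableSet S) {q : α → Measure β} (hq : Measurable q)
    (hprob : ∀ s ∈ S, IsProbabilityMeasure (q s)) :
    ∃ κ : ProbabilityTheory.Kernel α β, ProbabilityTheory.IsMarkovKernel κ ∧ Set.EqOn κ q S := by
  classical
  obtain ⟨b⟩ := ‹Nonempty β›
  refine ⟨⟨S.piecewise q fun _ => Measure.dirac b, hq.piecewise hS measurable_const⟩,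
    ⟨fun s => ?_⟩, fun s hs => by
      rw [ProbabilityTheory.Kernel.coe_mk, Set.piecewise_eq_of_mem _ _ _ hs]⟩
  by_cases hs : s ∈ S
  · have := hprob s hs
    simpa [hs] using this
  · simp only [ProbabilityTheory.Kernel.coe_mk, Set.piecewise_eq_of_notMem _ _ _ hs]
    infer_instance

/-- The integral against the image of a measure under a family of measures is an iterated integral
when the family agrees almost everywhere with a Markov kernel. -/
theorem integral_bind_of_ae_eq_kernel {α β : Type*} [MeasurableSpace α] [MeasurableSpace β]
    {μ : Measure α} [IsProbabilityMeasure μ] {q : α → Measure β}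
    (κ : ProbabilityTheory.Kernel α β) [ProbabilityTheory.IsMarkovKernel κ] (hκ : κ =ᵐ[μ] q)
    {f : β → ℝ} (hf : Measurable f) {C : ℝ} (hC : ∀ x, |f x| ≤ C) :
    ∫ x, f x ∂(μ.bind q) = ∫ s, ∫ x, f x ∂(κ s) ∂μ := by
  rw [← Measure.bind_congr_right hκ, Measure.comp_eq_comp_const_apply,
    ProbabilityTheory.Kernel.integral_comp, ProbabilityTheory.Kernel.const_apply]
  exact Integrable.of_bound hf.aestronglyMeasurable C (ae_of_all _ hC)

/-- Composing a function that is convex and increasing in its second argument with a convex function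
in that argument gives a convex function. -/
theorem ConvexOn.comp_graph {S A : Set ℝ} {H : ℝ × ℝ → ℝ} {g : ℝ → ℝ}
    (hH : ConvexOn ℝ (S ×ˢ A) H) (hmono : MonotoneOn H (S ×ˢ A)) (hA : Convex ℝ A)
    (hg : ConvexOn ℝ S g) (hgA : Set.MapsTo g S A) :
    ConvexOn ℝ S fun s => H (s, g s) := by
  refine ⟨hg.1, fun x hx y hy a b ha hb hab => ?_⟩
  have hxy := hg.1 hx hy ha hb hab
  calc H (a • x + b • y, g (a • x + b • y))
      ≤ H (a • x + b • y, a • g x + b • g y) :=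
        hmono ⟨hxy, hgA hxy⟩ ⟨hxy, hA (hgA hx) (hgA hy) ha hb hab⟩
          ⟨le_rfl, hg.2 hx hy ha hb hab⟩
    _ ≤ a • H (x, g x) + b • H (y, g y) :=
        hH.2 (x := (x, g x)) ⟨hx, hgA hx⟩ (y := (y, g y)) ⟨hy, hgA hy⟩ ha hb hab

/-- Key step of Proposition 4(ii): the stationary-distribution operator
`Φ(λ,p)(B) = ∫ p(s,g(s,p),B) λ(ds)` is increasing with respect to the increasing
convex order. -/
theorem stationary_operator_monotone_icx
    (lo hi : ℝ) (hlohi : lo ≤ hi)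
    -- the state space is the compact interval `S = [lo,hi]`
    (A : Set ℝ) (hAconv : Convex ℝ A)
    (p₁ p₂ : ℝ → ℝ → Measure ℝ)
    (hp₁meas : Measurable fun sa : ℝ × ℝ => p₁ sa.1 sa.2)
    (hp₂meas : Measurable fun sa : ℝ × ℝ => p₂ sa.1 sa.2)
    (hp₁prob : ∀ s ∈ Set.Icc lo hi, ∀ a ∈ A,
      IsProbabilityMeasure (p₁ s a) ∧ p₁ s a (Set.Icc lo hi) = 1)
    (hp₂prob : ∀ s ∈ Set.Icc lo hi, ∀ a ∈ A,
      IsProbabilityMeasure (p₂ s a) ∧ p₂ s a (Set.Icc lo hi) = 1)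
    -- `p₂` is monotone
    (hp₂mono : ∀ f : ℝ → ℝ, Measurable f → MonotoneOn f (Set.Icc lo hi) →
      (∃ C : ℝ, ∀ x, |f x| ≤ C) →
      MonotoneOn (fun sa : ℝ × ℝ => ∫ x, f x ∂(p₂ sa.1 sa.2)) (Set.Icc lo hi ×ˢ A))
    -- `p₂` is convexity-preserving
    (hp₂cx : ∀ f : ℝ → ℝ, Measurable f → ConvexOn ℝ (Set.Icc lo hi) f →
      (∃ C : ℝ, ∀ x, |f x| ≤ C) →
      ConvexOn ℝ (Set.Icc lo hi ×ˢ A)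
        (fun sa : ℝ × ℝ => ∫ x, f x ∂(p₂ sa.1 sa.2)))
    -- `p₂ ⪰_CX p₁`
    (hcx : ∀ f : ℝ → ℝ, Measurable f → ConvexOn ℝ (Set.Icc lo hi) f →
      (∃ C : ℝ, ∀ x, |f x| ≤ C) →
      ∀ s ∈ Set.Icc lo hi, ∀ a ∈ A, ∫ x, f x ∂(p₂ s a) ≥ ∫ x, f x ∂(p₁ s a))
    -- bounded measurable policy functions with values in `A`
    (g₁ g₂ : ℝ → ℝ)
    (hg₁meas : Measurable g₁) (hg₂meas : Measurable g₂)
    (hg₁bdd : ∃ C : ℝ, ∀ s, |g₁ s| ≤ C) (hg₂bdd : ∃ C : ℝ, ∀ s, |g₂ s| ≤ C)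
    (hg₁A : ∀ s ∈ Set.Icc lo hi, g₁ s ∈ A) (hg₂A : ∀ s ∈ Set.Icc lo hi, g₂ s ∈ A)
    -- `g₂` is increasing and convex and `g₂ ≥ g₁` on `S`
    (hg₂mono : MonotoneOn g₂ (Set.Icc lo hi))
    (hg₂conv : ConvexOn ℝ (Set.Icc lo hi) g₂)
    (hge : ∀ s ∈ Set.Icc lo hi, g₂ s ≥ g₁ s)
    -- probability measures `λ₁, λ₂` on `S` with `λ₂ ⪰_ICX λ₁`
    (lam₁ lam₂ : Measure ℝ)
    (hlam₁prob : IsProbabilityMeasure lam₁) (hlam₂prob : IsProbabilityMeasure lam₂)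
    (hlam₁supp : lam₁ (Set.Icc lo hi) = 1) (hlam₂supp : lam₂ (Set.Icc lo hi) = 1)
    (hlamicx : ∀ f : ℝ → ℝ, Measurable f → MonotoneOn f (Set.Icc lo hi) →
      ConvexOn ℝ (Set.Icc lo hi) f → (∃ C : ℝ, ∀ x, |f x| ≤ C) →
      ∫ x, f x ∂lam₂ ≥ ∫ x, f x ∂lam₁) :
    -- then `Φ₂(λ₂) ⪰_ICX Φ₁(λ₁)`
    ∀ f : ℝ → ℝ, Measurable f → MonotoneOn f (Set.Icc lo hi) →
      ConvexOn ℝ (Set.Icc lo hi) f → (∃ C : ℝ, ∀ x, |f x| ≤ C) →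
      ∫ x, f x ∂(lam₂.bind fun s => p₂ s (g₂ s)) ≥
        ∫ x, f x ∂(lam₁.bind fun s => p₁ s (g₁ s)) := by
  intro f hf hfmono hfconv ⟨C, hC⟩
  obtain ⟨κ₁, hκ₁, heq₁⟩ := exists_isMarkovKernel_eqOn (q := fun s => p₁ s (g₁ s))
    measurableSet_Icc (hp₁meas.comp (measurable_id.prodMk hg₁meas)) fun s hs => (hp₁prob s hs _ (hg₁A s hs)).1
  obtain ⟨κ₂, hκ₂, heq₂⟩ := exists_isMarkovKernel_eqOn (q := fun s => p₂ s (g₂ s))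
    measurableSet_Icc (hp₂meas.comp (measurable_id.prodMk hg₂meas)) fun s hs => (hp₂prob s hs _ (hg₂A s hs)).1
  have hae₁ : ∀ᵐ s ∂lam₁, s ∈ Set.Icc lo hi :=
    (prob_compl_eq_zero_iff measurableSet_Icc).2 hlam₁supp
  have hae₂ : ∀ᵐ s ∂lam₂, s ∈ Set.Icc lo hi :=
    (prob_compl_eq_zero_iff measurableSet_Icc).2 hlam₂supp
  have hmeas (κ : ProbabilityTheory.Kernel ℝ ℝ) [ProbabilityTheory.IsMarkovKernel κ] :
      Measurable fun s => ∫ x, f x ∂(κ s) :=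
    (hf.stronglyMeasurable.integral_kernel (κ := κ)).measurable
  have hbound (κ : ProbabilityTheory.Kernel ℝ ℝ) [ProbabilityTheory.IsMarkovKernel κ] (s : ℝ) :
      |∫ x, f x ∂(κ s)| ≤ C := by
    simpa using norm_integral_le_of_norm_le_const (μ := κ s) (f := f) (ae_of_all _ hC)
  have hint (κ : ProbabilityTheory.Kernel ℝ ℝ) [ProbabilityTheory.IsMarkovKernel κ] :
      Integrable (fun s => ∫ x, f x ∂(κ s)) lam₁ :=
    Integrable.of_bound (hmeas κ).aestronglyMeasurable C (ae_of_all _ (hbound κ))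
  have hval₂ : Set.EqOn (fun s => ∫ x, f x ∂(p₂ s (g₂ s))) (fun s => ∫ x, f x ∂(κ₂ s))
      (Set.Icc lo hi) := fun s hs => by simp [heq₂ hs]
  have hH := hp₂mono f hf hfmono ⟨C, hC⟩
  have hmono₂ : MonotoneOn (fun s => ∫ x, f x ∂(κ₂ s)) (Set.Icc lo hi) :=
    MonotoneOn.congr (fun s hs t ht hst =>
      hH (a := (s, g₂ s)) ⟨hs, hg₂A s hs⟩ (b := (t, g₂ t)) ⟨ht, hg₂A t ht⟩
        ⟨hst, hg₂mono hs ht hst⟩) hval₂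
  have hconv₂ : ConvexOn ℝ (Set.Icc lo hi) fun s => ∫ x, f x ∂(κ₂ s) :=
    ((hp₂cx f hf hfconv ⟨C, hC⟩).comp_graph hH hAconv hg₂conv hg₂A).congr hval₂
  rw [integral_bind_of_ae_eq_kernel κ₁ (hae₁.mono heq₁) hf hC,
    integral_bind_of_ae_eq_kernel κ₂ (hae₂.mono heq₂) hf hC]
  refine (integral_mono_ae (hint κ₁) (hint κ₂) ?_).trans
    (hlamicx _ (hmeas κ₂) hmono₂ hconv₂ ⟨C, hbound κ₂⟩)
  filter_upwards [hae₁] with s hs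
  rw [heq₁ hs, heq₂ hs]
  exact (hcx f hf hfconv ⟨C, hC⟩ s hs _ (hg₁A s hs)).le.trans
    (hH (a := (s, g₁ s)) ⟨hs, hg₁A s hs⟩ (b := (s, g₂ s)) ⟨hs, hg₂A s hs⟩ ⟨le_rfl, hge s hs⟩)
end

section
/- Let p be a monotone and convexity-preserving transition probability function and let g : S → A be an increasing and convex policy function. Then for every bounded increasing convex measurable f : S → ℝ, the function s ↦ ∫_S f(s′) p(s,g(s),ds′) is increasing and convex on S; that is, the induced Markov kernel P(s,·) = p(s,g(s),·) is ICX-preserving. -/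
set_option autoImplicit false

open MeasureTheory

/-- If `p` is a monotone and convexity-preserving transition probability function
and the policy function `g` is increasing and convex, then the induced kernel
`P(s,·) = p(s,g(s),·)` is ICX-preserving: for every bounded increasing convex
measurable `f`, the map `s ↦ ∫ f(s') p(s,g(s),ds')` is increasing and convex. -/
theorem induced_kernel_icx_preserving
    {n : ℕ} (S : Set (Fin n → ℝ)) (hSmeas : MeasurableSet S) (hSconv : Convex ℝ S)
    (A : Set ℝ) (hAconv : Convex ℝ A)
    (p : (Fin n → ℝ) → ℝ → Measure (Fin n → ℝ))
    (hpmeas : Measurable fun sa : (Fin n → ℝ) × ℝ => p sa.1 sa.2)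
    (hpprob : ∀ s ∈ S, ∀ a ∈ A, IsProbabilityMeasure (p s a) ∧ p s a S = 1)
    -- `p` is monotone
    (hpmono : ∀ f : (Fin n → ℝ) → ℝ, Measurable f → MonotoneOn f S →
      (∃ C : ℝ, ∀ x, |f x| ≤ C) →
      MonotoneOn (fun sa : (Fin n → ℝ) × ℝ => ∫ x, f x ∂(p sa.1 sa.2)) (S ×ˢ A))
    -- `p` is convexity-preserving
    (hpcx : ∀ f : (Fin n → ℝ) → ℝ, Measurable f → ConvexOn ℝ S f →
      (∃ C : ℝ, ∀ x, |f x| ≤ C) →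
      ConvexOn ℝ (S ×ˢ A) (fun sa : (Fin n → ℝ) × ℝ => ∫ x, f x ∂(p sa.1 sa.2)))
    -- the policy function `g` is increasing and convex with values in `A`
    (g : (Fin n → ℝ) → ℝ)
    (hgA : ∀ s ∈ S, g s ∈ A)
    (hgmono : MonotoneOn g S) (hgconv : ConvexOn ℝ S g) :
    ∀ f : (Fin n → ℝ) → ℝ, Measurable f → MonotoneOn f S → ConvexOn ℝ S f →
      (∃ C : ℝ, ∀ x, |f x| ≤ C) →
      MonotoneOn (fun s => ∫ x, f x ∂(p s (g s))) S ∧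
        ConvexOn ℝ S (fun s => ∫ x, f x ∂(p s (g s))) := by
  intro f hf hfmono hfconv hfbdd
  have hmono := hpmono f hf hfmono hfbdd
  have hcx := hpcx f hf hfconv hfbdd
  refine ⟨fun x hx y hy hxy => hmono (a := (x, g x)) (b := (y, g y))
    ⟨hx, hgA x hx⟩ ⟨hy, hgA y hy⟩ ⟨hxy, hgmono hx hy hxy⟩, hSconv, ?_⟩
  intro x hx y hy a b ha hb hab
  have hz := hSconv hx hy ha hb hab
  exact (hmono (a := (a • x + b • y, g (a • x + b • y)))
    (b := (a • x + b • y, a • g x + b • g y)) ⟨hz, hgA _ hz⟩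
    ⟨hz, hAconv (hgA x hx) (hgA y hy) ha hb hab⟩
    ⟨le_rfl, hgconv.2 hx hy ha hb hab⟩).trans
    (hcx.2 (x := (x, g x)) ⟨hx, hgA x hx⟩ (y := (y, g y)) ⟨hy, hgA y hy⟩ ha hb hab)
end
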